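/- arXiv:2309.11185 — 2 statements merged into one kernel-verified Lean document; each statement's English description precedes it below -/
import Mathlib

section
/- (Identity linking v and ρ.) For every τ ∈ [0,1], every even integer N ≥ 2 and every t ∈ ℝ: (2/(1+τ))·v″(t) − 2(1−τ)·t·v′(t) − 2(τ(1+τ)t² + (1+τ)(N−1) + 1)·v(t) = ρ′(t) + τ(1+τ)·t·ρ(t) − (2(N−1)τ/(N−2)!)·∫_ℝ e^{tx}·(e^{−x²/(1+τ)}/√(2π))·C_{N−2}(x)² dx. -/
open Real MeasureTheory Finset

/-- The rescaled (monic-type) Hermite polynomials `C_k` with parameter `τ`: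
`C_0(x) = 1`, `C_1(x) = x`, `C_{k+1}(x) = x·C_k(x) − k·τ·C_{k−1}(x)`. -/
noncomputable def CH (τ : ℝ) : ℕ → ℝ → ℝ
  | 0 => fun _ => 1
  | 1 => fun x => x
  | (k+2) => fun x => x * CH τ (k+1) x - ((k : ℝ) + 1) * τ * CH τ k x

/-- The elliptic GinUE part `R_N^{(1)}` of the real-eigenvalue density. -/
noncomputable def R1 (τ : ℝ) (N : ℕ) (x : ℝ) : ℝ :=
  (Real.exp (-x^2/(1+τ)) / Real.sqrt (2*Real.pi)) *
    ∑ k ∈ Finset.range (N-1), (CH τ k x)^2 / (Nat.factorial k : ℝ)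

/-- The correction part `R_N^{(2)}` of the real-eigenvalue density. -/
noncomputable def R2 (τ : ℝ) (N : ℕ) (x : ℝ) : ℝ :=
  (1/((1+τ) * (Nat.factorial (N-2) : ℝ))) * (Real.exp (-x^2/(2*(1+τ))) / Real.sqrt (2*Real.pi)) *
    CH τ (N-1) x * (∫ u in (0:ℝ)..x, Real.exp (-u^2/(2*(1+τ))) * CH τ (N-2) u)

/-- The density `R_N` of real eigenvalues of the elliptic GinOE. -/
noncomputable def Rd (τ : ℝ) (N : ℕ) (x : ℝ) : ℝ := R1 τ N x + R2 τ N x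

/-- The moment generating function of real eigenvalues of the elliptic GinOE. -/
noncomputable def MGF (τ : ℝ) (N : ℕ) (t : ℝ) : ℝ := ∫ x : ℝ, Real.exp (t*x) * Rd τ N x

/-- The `p`-th spectral moment of real eigenvalues of the elliptic GinOE. -/
noncomputable def Mom (τ : ℝ) (N : ℕ) (p : ℕ) : ℝ := ∫ x : ℝ, x^p * Rd τ N x

/-- The elliptic GinUE part `u` of the moment generating function. -/
noncomputable def uF (τ : ℝ) (N : ℕ) (t : ℝ) : ℝ := ∫ x : ℝ, Real.exp (t*x) * R1 τ N x

/-- The part `v` of the moment generating function coming from `R_N^{(2)}`. -/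
noncomputable def vF (τ : ℝ) (N : ℕ) (t : ℝ) : ℝ := ∫ x : ℝ, Real.exp (t*x) * R2 τ N x

/-- The function `ρ(t) = (2/((1+τ)(N−2)!))·∫_ℝ e^{tx}·C_{N−2}(x)·C_{N−1}(x)·
(e^{−x²/(1+τ)}/√(2π)) dx`. -/
noncomputable def rhoF (τ : ℝ) (N : ℕ) (t : ℝ) : ℝ :=
  (2/((1+τ) * (Nat.factorial (N-2) : ℝ))) *
    ∫ x : ℝ, Real.exp (t*x) * CH τ (N-2) x * CH τ (N-1) x *
      (Real.exp (-x^2/(1+τ)) / Real.sqrt (2*Real.pi))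

/-- A continuous function on the line that decays faster than every exponential. -/
structure SuperExpDecay (h : ℝ → ℝ) : Prop where
  continuous : Continuous h
  bound : ∀ s : ℝ, ∃ C : ℝ, ∀ x, |h x| ≤ C * exp (-(s * |x|))

namespace SuperExpDecay

variable {g h : ℝ → ℝ}

lemma mul_of_le_exp (hh : SuperExpDecay h) (hg : Continuous g) (A s₀ : ℝ)
    (hle : ∀ x, |g x| ≤ A * exp (s₀ * |x|)) : SuperExpDecay (fun x => g x * h x) := by
  refine ⟨hg.mul hh.continuous, fun s => ?_⟩
  obtain ⟨C, hC⟩ := hh.bound (s₀ + s)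
  refine ⟨A * C, fun x => ?_⟩
  rw [abs_mul]
  calc |g x| * |h x| ≤ (A * exp (s₀ * |x|)) * (C * exp (-((s₀ + s) * |x|))) :=
        mul_le_mul (hle x) (hC x) (abs_nonneg _) ((abs_nonneg _).trans (hle x))
    _ = A * C * (exp (s₀ * |x|) * exp (-((s₀ + s) * |x|))) := by ring
    _ = A * C * exp (-(s * |x|)) := by rw [← exp_add]; ring_nf

lemma bounded_mul (hh : SuperExpDecay h) (hg : Continuous g) (A : ℝ) (hle : ∀ x, |g x| ≤ A) :
    SuperExpDecay (fun x => g x * h x) :=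
  hh.mul_of_le_exp hg A 0 (by simpa using hle)

lemma const_mul (hh : SuperExpDecay h) (c : ℝ) : SuperExpDecay (fun x => c * h x) :=
  hh.bounded_mul continuous_const |c| fun _ => le_rfl

lemma id_mul (hh : SuperExpDecay h) : SuperExpDecay (fun x => x * h x) :=
  hh.mul_of_le_exp continuous_id 1 1 fun x => by
    have := add_one_le_exp |x|
    rw [one_mul, one_mul]
    exact (le_add_of_nonneg_right zero_le_one).trans this

lemma exp_mul (hh : SuperExpDecay h) (t : ℝ) : SuperExpDecay (fun x => exp (t * x) * h x) :=
  hh.mul_of_le_exp (by fun_prop) 1 |t| fun x => by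
    rw [abs_of_pos (exp_pos _), one_mul, exp_le_exp, ← abs_mul]
    exact le_abs_self _

lemma add (hg : SuperExpDecay g) (hh : SuperExpDecay h) : SuperExpDecay (fun x => g x + h x) := by
  refine ⟨hg.continuous.add hh.continuous, fun s => ?_⟩
  obtain ⟨A, hA⟩ := hg.bound s
  obtain ⟨B, hB⟩ := hh.bound s
  refine ⟨A + B, fun x => ?_⟩
  linarith [abs_add_le (g x) (h x), hA x, hB x]

lemma mul_CH (hh : SuperExpDecay h) (τ : ℝ) (k : ℕ) : SuperExpDecay (fun x => CH τ k x * h x) := by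
  induction k using Nat.twoStepInduction with
  | zero => simpa [CH] using hh
  | one => simpa [CH] using hh.id_mul
  | more k ih₀ ih₁ =>
    convert ih₁.id_mul.add (ih₀.const_mul (-(((k : ℝ) + 1) * τ))) using 2 with x
    simp only [CH]
    ring

lemma integrable (hh : SuperExpDecay h) : Integrable h := by
  obtain ⟨C, hC⟩ := hh.bound 2
  refine (integrable_inv_one_add_sq.const_mul C).mono' hh.continuous.aestronglyMeasurable
    (ae_of_all _ fun x => (hC x).trans ?_)
  have hC0 : 0 ≤ C := by simpa using (abs_nonneg _).trans (hC 0)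
  refine mul_le_mul_of_nonneg_left ?_ hC0
  rw [exp_neg]
  refine inv_anti₀ (by positivity) ?_
  have h1 := add_one_le_exp |x|
  have h2 : exp (2 * |x|) = exp |x| ^ 2 := by rw [← exp_nat_mul]; norm_num
  rw [h2, ← sq_abs x]
  nlinarith [abs_nonneg x]

/-- Differentiation of the two-sided Laplace transform under the integral sign. -/
lemma hasDerivAt_integral_exp_mul (hh : SuperExpDecay h) (t : ℝ) :
    HasDerivAt (fun s => ∫ x, exp (s * x) * h x) (∫ x, exp (t * x) * (x * h x)) t := by
  have hb : SuperExpDecay (fun x => exp ((|t| + 1) * |x|) * (x * h x)) :=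
    hh.id_mul.mul_of_le_exp (by fun_prop) 1 (|t| + 1) fun x => by
      rw [abs_of_pos (exp_pos _), one_mul]
  refine (hasDerivAt_integral_of_dominated_loc_of_deriv_le
    (F := fun s x => exp (s * x) * h x) (F' := fun s x => exp (s * x) * (x * h x))
    (Metric.ball_mem_nhds t one_pos)
    (Filter.Eventually.of_forall fun s => (hh.exp_mul s).continuous.aestronglyMeasurable)
    (hh.exp_mul t).integrable (hh.id_mul.exp_mul t).continuous.aestronglyMeasurable
    (ae_of_all _ fun x s hs => ?_) hb.integrable.norm (ae_of_all _ fun x s _ => ?_)).2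
  · have hs' : |s| ≤ |t| + 1 := by
      rw [Metric.mem_ball, dist_eq] at hs
      have := abs_add_le (s - t) t
      rw [sub_add_cancel] at this
      linarith
    rw [norm_mul, norm_mul (exp _)]
    refine mul_le_mul_of_nonneg_right ?_ (norm_nonneg _)
    rw [norm_of_nonneg (exp_pos _).le, norm_of_nonneg (exp_pos _).le, exp_le_exp]
    calc s * x ≤ |s| * |x| := by rw [← abs_mul]; exact le_abs_self _
      _ ≤ _ := mul_le_mul_of_nonneg_right hs' (abs_nonneg _)
  · refine (((hasDerivAt_mul_const x).exp).mul_const (h x)).congr_deriv ?_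
    ring

lemma abs_intervalIntegral_le (hh : SuperExpDecay h) (a x : ℝ) :
    |∫ u in a..x, h u| ≤ ∫ u, |h u| :=
  intervalIntegral.norm_integral_le_integral_norm_uIoc.trans
    (setIntegral_le_integral hh.integrable.norm (ae_of_all _ fun _ => norm_nonneg _))

end SuperExpDecay

lemma superExpDecay_gaussian {b : ℝ} (hb : 0 < b) : SuperExpDecay (fun x => exp (-x ^ 2 / b)) := by
  refine ⟨by fun_prop, fun s => ⟨exp (s ^ 2 * b / 4), fun x => ?_⟩⟩
  rw [abs_of_pos (exp_pos _), ← exp_add, exp_le_exp, div_le_iff₀ hb, ← sq_abs x]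
  nlinarith [sq_nonneg (|x| - s * b / 2)]

lemma hasDerivAt_CH (τ : ℝ) (k : ℕ) (x : ℝ) :
    HasDerivAt (CH τ (k + 1)) (((k : ℝ) + 1) * CH τ k x) x := by
  induction k using Nat.twoStepInduction with
  | zero => exact (hasDerivAt_id x).congr_deriv (by simp [CH])
  | one =>
    have h := ((hasDerivAt_id x).mul (hasDerivAt_id x)).sub_const τ
    have hfun : CH τ (1 + 1) = fun y => y * y - τ := by
      funext y
      simp [CH]
    rw [hfun]
    refine h.congr_deriv ?_
    simp [CH]
    ring
  | more k ih₀ ih₁ =>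
    refine (((hasDerivAt_id x).mul ih₁).sub
      (ih₀.const_mul ((((k + 1 : ℕ) : ℝ) + 1) * τ))).congr_deriv ?_
    simp only [CH, id]
    push_cast
    ring

/-- The lowering relation `τ C_m' = x C_m - C_{m+1}`. -/
lemma exists_hasDerivAt_CH (τ : ℝ) (m : ℕ) (x : ℝ) :
    ∃ q, HasDerivAt (CH τ m) q x ∧ τ * q = x * CH τ m x - CH τ (m + 1) x := by
  cases m with
  | zero => exact ⟨0, hasDerivAt_const x 1, by simp [CH]⟩
  | succ k =>
    refine ⟨_, hasDerivAt_CH τ k x, ?_⟩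
    simp only [CH]
    ring

lemma superExpDecay_R2 {τ : ℝ} (ha : 0 < 1 + τ) (N : ℕ) : SuperExpDecay (R2 τ N) := by
  have hw := superExpDecay_gaussian (b := 2 * (1 + τ)) (by positivity)
  have hu : SuperExpDecay (fun u => exp (-u ^ 2 / (2 * (1 + τ))) * CH τ (N - 2) u) := by
    simpa only [mul_comm] using hw.mul_CH τ (N - 2)
  have hF : Continuous (fun x : ℝ =>
      ∫ u in (0 : ℝ)..x, exp (-u ^ 2 / (2 * (1 + τ))) * CH τ (N - 2) u) :=
    intervalIntegral.continuous_primitive (fun _ _ => hu.continuous.intervalIntegrable _ _) 0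
  convert (((hw.mul_CH τ (N - 1)).bounded_mul hF _ (hu.abs_intervalIntegral_le 0)).const_mul
    (1 / ((1 + τ) * (Nat.factorial (N - 2) : ℝ)) / √(2 * π))) using 2 with x
  rw [R2]
  ring

/-- The boundary term whose derivative is the difference of the integrands of the two sides. -/
noncomputable def boundaryTerm (τ : ℝ) (m : ℕ) (t x : ℝ) : ℝ :=
  exp (t * x) * (1 / ((1 + τ) * (Nat.factorial m : ℝ)) / √(2 * π) *
    (exp (-x ^ 2 / (2 * (1 + τ))) *
      ((∫ u in (0 : ℝ)..x, exp (-u ^ 2 / (2 * (1 + τ))) * CH τ m u) *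
        (2 * τ * (1 + τ) * ((m : ℝ) + 1) * CH τ m x
          - 2 * (x * CH τ (m + 1) x) - 2 * τ * (1 + τ) * t * CH τ (m + 1) x))))

lemma integrable_boundaryTerm {τ : ℝ} (ha : 0 < 1 + τ) (m : ℕ) (t : ℝ) :
    Integrable (boundaryTerm τ m t) := by
  have hw := superExpDecay_gaussian (b := 2 * (1 + τ)) (by positivity)
  have hu : SuperExpDecay (fun u => exp (-u ^ 2 / (2 * (1 + τ))) * CH τ m u) := by
    simpa only [mul_comm] using hw.mul_CH τ m
  have hF : Continuous (fun x : ℝ =>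
      ∫ u in (0 : ℝ)..x, exp (-u ^ 2 / (2 * (1 + τ))) * CH τ m u) :=
    intervalIntegral.continuous_primitive (fun _ _ => hu.continuous.intervalIntegrable _ _) 0
  have hP := hw.mul_CH τ (m + 1)
  have hE := (((hw.mul_CH τ m).const_mul (2 * τ * (1 + τ) * ((m : ℝ) + 1))).add
    (hP.id_mul.const_mul (-2))).add (hP.const_mul (-(2 * τ * (1 + τ) * t)))
  convert (((hE.bounded_mul hF _ (hu.abs_intervalIntegral_le 0)).const_mul
    (1 / ((1 + τ) * (Nat.factorial m : ℝ)) / √(2 * π))).exp_mul t).integrable using 2 with x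
  rw [boundaryTerm]
  ring

lemma hasDerivAt_boundaryTerm {τ : ℝ} (ha : 0 < 1 + τ) (m : ℕ) (t x : ℝ) :
    HasDerivAt (boundaryTerm τ m t)
      ((2 / (1 + τ)) * (exp (t * x) * (x * (x * R2 τ (m + 2) x)))
        - 2 * (1 - τ) * t * (exp (t * x) * (x * R2 τ (m + 2) x))
        - 2 * (τ * (1 + τ) * t ^ 2 + (1 + τ) * ((m : ℝ) + 1) + 1) *
          (exp (t * x) * R2 τ (m + 2) x)
        - (2 / ((1 + τ) * (Nat.factorial m : ℝ))) * (exp (t * x) *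
          (x * (CH τ m x * CH τ (m + 1) x * (exp (-x ^ 2 / (1 + τ)) / √(2 * π)))))
        - τ * (1 + τ) * t * (2 / ((1 + τ) * (Nat.factorial m : ℝ))) * (exp (t * x) *
          (CH τ m x * CH τ (m + 1) x * (exp (-x ^ 2 / (1 + τ)) / √(2 * π))))
        + (2 * ((m : ℝ) + 1) * τ / (Nat.factorial m : ℝ)) *
          (exp (t * x) * (exp (-x ^ 2 / (1 + τ)) / √(2 * π) * CH τ m x ^ 2))) x := by
  obtain ⟨q, hQ, hq⟩ := exists_hasDerivAt_CH τ m x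
  have hP := hasDerivAt_CH τ m x
  have hw : HasDerivAt (fun x : ℝ => exp (-x ^ 2 / (2 * (1 + τ))))
      (exp (-x ^ 2 / (2 * (1 + τ))) * (-x / (1 + τ))) x := by
    refine (((hasDerivAt_pow 2 x).neg.div_const (2 * (1 + τ))).exp).congr_deriv ?_
    simp only [Pi.neg_apply]
    field_simp
    norm_num
    ring
  have hc : Continuous (fun u => exp (-u ^ 2 / (2 * (1 + τ))) * CH τ m u) := by
    simpa only [mul_comm] using
      ((superExpDecay_gaussian (b := 2 * (1 + τ)) (by positivity)).mul_CH τ m).continuous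
  have hF := (hc.integral_hasStrictDerivAt 0 x).hasDerivAt
  have he : HasDerivAt (fun x : ℝ => exp (t * x)) (exp (t * x) * t) x := by
    simpa using ((hasDerivAt_id x).const_mul t).exp
  have hE := ((hQ.const_mul (2 * τ * (1 + τ) * ((m : ℝ) + 1))).sub
    (((hasDerivAt_id x).mul hP).const_mul 2)).sub (hP.const_mul (2 * τ * (1 + τ) * t))
  have hW : exp (-x ^ 2 / (1 + τ)) = exp (-x ^ 2 / (2 * (1 + τ))) ^ 2 := by
    rw [← exp_nat_mul]
    congr 1
    field_simp
    norm_num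
  refine (he.mul ((hw.mul (hF.mul hE)).const_mul
    (1 / ((1 + τ) * (Nat.factorial m : ℝ)) / √(2 * π)))).congr_deriv ?_
  simp only [R2, hW, Nat.add_sub_cancel, Nat.add_succ_sub_one, Pi.mul_apply, Pi.sub_apply, id]
  have ha' : 1 + τ ≠ 0 := ha.ne'
  have hm : (Nat.factorial m : ℝ) ≠ 0 := by positivity
  have hs : √(2 * π) ≠ 0 := by positivity
  generalize (∫ u in (0 : ℝ)..x, exp (-u ^ 2 / (2 * (1 + τ))) * CH τ m u) = F
  generalize exp (-x ^ 2 / (2 * (1 + τ))) = w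
  have hP' : CH τ (m + 1) x = x * CH τ m x - τ * q := by linarith
  rw [hP']
  field_simp
  ring

/-- **Theorem (Identity linking `v` and `ρ`).** -/
theorem v_rho_identity (τ : ℝ) (hτ : τ ∈ Set.Icc (0:ℝ) 1)
    (N : ℕ) (hNeven : Even N) (hN2 : 2 ≤ N) (t : ℝ) :
    (2/(1+τ)) * iteratedDeriv 2 (vF τ N) t - 2*(1-τ) * t * deriv (vF τ N) t
      - 2*(τ*(1+τ)*t^2 + (1+τ)*((N:ℝ)-1) + 1) * vF τ N t
    = deriv (rhoF τ N) t + τ*(1+τ) * t * rhoF τ N t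
      - (2*((N:ℝ)-1)*τ/(Nat.factorial (N-2) : ℝ)) *
          ∫ x : ℝ, Real.exp (t*x) * (Real.exp (-x^2/(1+τ)) / Real.sqrt (2*Real.pi)) *
            (CH τ (N-2) x)^2 := by
  obtain ⟨m, rfl⟩ : ∃ m, N = m + 2 := ⟨N - 2, by omega⟩
  have ha : 0 < 1 + τ := by linarith [hτ.1]
  have hR := superExpDecay_R2 ha (m + 2)
  have hW := (superExpDecay_gaussian ha).const_mul (√(2 * π))⁻¹
  have hρ : SuperExpDecay (fun x =>
      CH τ m x * CH τ (m + 1) x * (exp (-x ^ 2 / (1 + τ)) / √(2 * π))) := by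
    convert (hW.mul_CH τ (m + 1)).mul_CH τ m using 2 with x
    ring
  have hQ : SuperExpDecay (fun x => exp (-x ^ 2 / (1 + τ)) / √(2 * π) * CH τ m x ^ 2) := by
    convert (hW.mul_CH τ m).mul_CH τ m using 2 with x
    ring
  have hv' : deriv (vF τ (m + 2)) = fun s => ∫ x, exp (s * x) * (x * R2 τ (m + 2) x) :=
    funext fun s => (hR.hasDerivAt_integral_exp_mul s).deriv
  have hv'' : iteratedDeriv 2 (vF τ (m + 2)) t
      = ∫ x, exp (t * x) * (x * (x * R2 τ (m + 2) x)) := by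
    rw [iteratedDeriv_succ, iteratedDeriv_one, hv']
    exact (hR.id_mul.hasDerivAt_integral_exp_mul t).deriv
  have hrho : rhoF τ (m + 2) = fun s => (2 / ((1 + τ) * (Nat.factorial m : ℝ))) *
      ∫ x, exp (s * x) * (CH τ m x * CH τ (m + 1) x * (exp (-x ^ 2 / (1 + τ)) / √(2 * π))) := by
    funext s
    simp only [rhoF, Nat.add_sub_cancel, Nat.add_succ_sub_one, mul_assoc]
  have hrho' := ((hρ.hasDerivAt_integral_exp_mul t).const_mul
    (2 / ((1 + τ) * (Nat.factorial m : ℝ)))).deriv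
  have i₁ := (hR.id_mul.id_mul.exp_mul t).integrable.const_mul (2 / (1 + τ))
  have i₂ := (hR.id_mul.exp_mul t).integrable.const_mul (2 * (1 - τ) * t)
  have i₃ := (hR.exp_mul t).integrable.const_mul
    (2 * (τ * (1 + τ) * t ^ 2 + (1 + τ) * ((m : ℝ) + 1) + 1))
  have i₄ := (hρ.id_mul.exp_mul t).integrable.const_mul (2 / ((1 + τ) * (Nat.factorial m : ℝ)))
  have i₅ := (hρ.exp_mul t).integrable.const_mul
    (τ * (1 + τ) * t * (2 / ((1 + τ) * (Nat.factorial m : ℝ))))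
  have i₆ := (hQ.exp_mul t).integrable.const_mul (2 * ((m : ℝ) + 1) * τ / (Nat.factorial m : ℝ))
  have i₁₂ := i₁.sub i₂
  have i₁₃ := i₁₂.sub i₃
  have i₁₄ := i₁₃.sub i₄
  have i₁₅ := i₁₄.sub i₅
  have key := integral_eq_zero_of_hasDerivAt_of_integrable
    (hasDerivAt_boundaryTerm ha m t) (i₁₅.add i₆) (integrable_boundaryTerm ha m t)
  have hsplit := integral_add' i₁₅ i₆
  rw [integral_sub' i₁₄ i₅, integral_sub' i₁₃ i₄, integral_sub' i₁₂ i₃,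
    integral_sub' i₁ i₂] at hsplit
  replace key := hsplit.symm.trans key
  simp only [integral_const_mul] at key
  rw [hv'', hv', hrho, hrho']
  simp only [vF, Nat.add_sub_cancel, mul_assoc] at key ⊢
  push_cast
  linear_combination key
end

section
/- (Skew-orthogonal summation identity, even–odd part.) For every τ ∈ [0,1], every even integer N ≥ 2 and every x ∈ ℝ: Σ_{k=0}^{N/2−1} Φ_{2k}(x)·p_{2k+1}(x)/(2k)! = 2(1+τ)·e^{−x²/(2(1+τ))}·Σ_{k=0}^{N/2−2} C_{2k+1}(x)²/(2k+1)! + C_{N−1}(x)·Φ_{N−2}(x)/(N−2)! (for N = 2 the sum Σ_{k=0}^{N/2−2} is empty). -/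
open Real MeasureTheory Finset

/-- The skew-orthogonal polynomials of the elliptic GinOE:
`p_{2k} = C_{2k}`, `p_{2k+1} = C_{2k+1} − 2k·C_{2k−1}`. -/
noncomputable def pSO (τ : ℝ) (k : ℕ) (x : ℝ) : ℝ :=
  if k % 2 = 0 then CH τ k x else CH τ k x - ((k:ℝ)-1) * CH τ (k-2) x

/-- `Φ_k(x) = ∫_ℝ sgn(x−y)·p_k(y)·e^{−y²/(2(1+τ))} dy`. -/
noncomputable def PhiF (τ : ℝ) (k : ℕ) (x : ℝ) : ℝ :=
  ∫ y : ℝ, Real.sign (x - y) * pSO τ k y * Real.exp (-y^2/(2*(1+τ)))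

theorem hasDerivAt_CH_succ (τ : ℝ) (n : ℕ) (x : ℝ) :
    HasDerivAt (CH τ (n + 1)) (((n : ℝ) + 1) * CH τ n x) x := by
  induction n using Nat.twoStepInduction with
  | zero => simpa [CH] using hasDerivAt_id' x
  | one =>
    have h := ((hasDerivAt_id x).mul (hasDerivAt_id x)).sub_const τ
    convert! h using 1
    · funext y; simp [CH]
    · simp [CH]; ring
  | more n ih₀ ih₁ =>
    have h := ((hasDerivAt_id x).mul ih₁).sub (ih₀.const_mul (((n : ℝ) + 2) * τ))
    convert! h using 1
    · funext y
      simp only [CH, Pi.sub_apply, Pi.mul_apply, id]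
      push_cast
      ring
    · simp only [CH, id]
      push_cast
      ring

theorem integrable_pow_mul_exp_neg_sq_div {c : ℝ} (hc : 0 < c) (j : ℕ) :
    Integrable fun y : ℝ => y ^ j * exp (-y ^ 2 / c) := by
  have h := integrable_rpow_mul_exp_neg_mul_sq (inv_pos.2 hc) (s := j)
    (by have := j.cast_nonneg (α := ℝ); linarith)
  refine h.congr (.of_forall fun y => ?_)
  simp only [rpow_natCast]
  congr 2
  ring

theorem integrable_pow_mul_CH_mul_exp (τ : ℝ) {c : ℝ} (hc : 0 < c) (n j : ℕ) :
    Integrable fun y : ℝ => y ^ j * CH τ n y * exp (-y ^ 2 / c) := by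
  induction n using Nat.twoStepInduction generalizing j with
  | zero => simpa [CH] using integrable_pow_mul_exp_neg_sq_div hc j
  | one => simpa [CH, pow_succ] using integrable_pow_mul_exp_neg_sq_div hc (j + 1)
  | more n ih₀ ih₁ =>
    refine ((ih₁ (j + 1)).sub ((ih₀ j).const_mul (((n : ℝ) + 1) * τ))).congr
      (.of_forall fun y => ?_)
    simp only [CH, Pi.sub_apply]
    ring

theorem integrable_CH_mul_exp (τ : ℝ) {c : ℝ} (hc : 0 < c) (n : ℕ) :
    Integrable fun y : ℝ => CH τ n y * exp (-y ^ 2 / c) := by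
  simpa using integrable_pow_mul_CH_mul_exp τ hc n 0

theorem integrable_sign_sub_mul {f : ℝ → ℝ} (hf : Integrable f) (x : ℝ) :
    Integrable fun y => Real.sign (x - y) * f y := by
  rw [← integrableOn_univ, ← Set.Iic_union_Ioi (a := x), ← Set.Iio_union_right,
    integrableOn_union, integrableOn_union]
  refine ⟨⟨?_, by simp⟩, ?_⟩
  · refine hf.integrableOn.congr_fun (fun y hy => ?_) measurableSet_Iio
    simp [Real.sign_of_pos (sub_pos.2 hy)]
  · refine hf.neg.integrableOn.congr_fun (fun y hy => ?_) measurableSet_Ioi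
    simp [Real.sign_of_neg (sub_neg.2 hy)]

/-- Convolving an integrable derivative with the sign function recovers twice the primitive. -/
theorem integral_sign_sub_mul_of_hasDerivAt {f f' : ℝ → ℝ}
    (hderiv : ∀ y, HasDerivAt f (f' y) y) (hf' : Integrable f') (hf : Integrable f) (x : ℝ) :
    ∫ y, Real.sign (x - y) * f' y = 2 * f x := by
  have hsign := integrable_sign_sub_mul hf' x
  rw [← intervalIntegral.integral_Iic_add_Ioi (b := x) hsign.integrableOn hsign.integrableOn]
  have hbot := integral_Iic_of_hasDerivAt_of_tendsto' (a := x) (fun y _ => hderiv y)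
    hf'.integrableOn (tendsto_zero_of_hasDerivAt_of_integrableOn_Iic (a := x)
      (fun y _ => hderiv y) hf'.integrableOn hf.integrableOn)
  have htop := integral_Ioi_of_hasDerivAt_of_tendsto' (a := x) (fun y _ => hderiv y)
    hf'.integrableOn (tendsto_zero_of_hasDerivAt_of_integrableOn_Ioi (a := x)
      (fun y _ => hderiv y) hf'.integrableOn hf.integrableOn)
  have hIic : ∫ y in Set.Iic x, Real.sign (x - y) * f' y = ∫ y in Set.Iic x, f' y := by
    rw [integral_Iic_eq_integral_Iio, integral_Iic_eq_integral_Iio]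
    refine setIntegral_congr_fun measurableSet_Iio fun y hy => ?_
    simp [Real.sign_of_pos (sub_pos.2 hy)]
  have hIoi : ∫ y in Set.Ioi x, Real.sign (x - y) * f' y = -∫ y in Set.Ioi x, f' y := by
    rw [← integral_neg]
    refine setIntegral_congr_fun measurableSet_Ioi fun y hy => ?_
    simp [Real.sign_of_neg (sub_neg.2 hy)]
  rw [hIic, hIoi, hbot, htop]
  ring

theorem hasDerivAt_CH_succ_mul_exp {τ : ℝ} (hτ : 0 < 1 + τ) (n : ℕ) (x : ℝ) :
    HasDerivAt (fun y => (1 + τ) * (CH τ (n + 1) y * exp (-y ^ 2 / (2 * (1 + τ)))))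
      (((n : ℝ) + 1) * (CH τ n x * exp (-x ^ 2 / (2 * (1 + τ)))) -
        CH τ (n + 2) x * exp (-x ^ 2 / (2 * (1 + τ)))) x := by
  have hexp : HasDerivAt (fun y : ℝ => -y ^ 2 / (2 * (1 + τ))) (-x / (1 + τ)) x := by
    convert! ((hasDerivAt_pow 2 x).neg.div_const (2 * (1 + τ))) using 1
    field_simp
    simp [mul_comm]
  convert! ((hasDerivAt_CH_succ τ n x).mul hexp.exp).const_mul (1 + τ) using 1
  simp only [CH]
  field_simp
  ring

theorem PhiF_even (τ : ℝ) (k : ℕ) (x : ℝ) :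
    PhiF τ (2 * k) x =
      ∫ y, Real.sign (x - y) * (CH τ (2 * k) y * exp (-y ^ 2 / (2 * (1 + τ)))) := by
  simp [PhiF, pSO, mul_assoc]

theorem PhiF_even_succ {τ : ℝ} (hτ : 0 < 1 + τ) (k : ℕ) (x : ℝ) :
    PhiF τ (2 * (k + 1)) x = (2 * (k : ℝ) + 1) * PhiF τ (2 * k) x -
      2 * (1 + τ) * exp (-x ^ 2 / (2 * (1 + τ))) * CH τ (2 * k + 1) x := by
  have hc : 0 < 2 * (1 + τ) := by linarith
  have hint := integrable_CH_mul_exp τ hc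
  have h := integral_sign_sub_mul_of_hasDerivAt (hasDerivAt_CH_succ_mul_exp hτ (2 * k))
    (((hint _).const_mul _).sub (hint _)) ((hint _).const_mul _) x
  simp only [mul_sub, mul_left_comm (Real.sign _) (((2 * k : ℕ) : ℝ) + 1)] at h
  rw [integral_sub ((integrable_sign_sub_mul (hint _) x).const_mul _)
    (integrable_sign_sub_mul (hint _) x), integral_const_mul, ← PhiF_even,
    show 2 * k + 2 = 2 * (k + 1) by ring, ← PhiF_even] at h
  push_cast at h
  linarith

theorem pSO_odd_succ (τ : ℝ) (k : ℕ) (x : ℝ) :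
    pSO τ (2 * (k + 1) + 1) x =
      CH τ (2 * (k + 1) + 1) x - (2 * (k : ℝ) + 2) * CH τ (2 * k + 1) x := by
  have hodd : (2 * (k + 1) + 1) % 2 ≠ 0 := by omega
  rw [pSO, if_neg hodd, show 2 * (k + 1) + 1 - 2 = 2 * k + 1 by omega]
  push_cast
  ring

theorem sum_PhiF_even_mul_pSO_odd {τ : ℝ} (hτ : 0 < 1 + τ) (m : ℕ) (x : ℝ) :
    ∑ k ∈ Finset.range (m + 1),
        PhiF τ (2 * k) x * pSO τ (2 * k + 1) x / (Nat.factorial (2 * k) : ℝ)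
      = 2 * (1 + τ) * exp (-x ^ 2 / (2 * (1 + τ))) *
          (∑ k ∈ Finset.range m, (CH τ (2 * k + 1) x) ^ 2 / (Nat.factorial (2 * k + 1) : ℝ))
        + CH τ (2 * m + 1) x * PhiF τ (2 * m) x / (Nat.factorial (2 * m) : ℝ) := by
  induction m with
  | zero => simp [pSO, mul_comm]
  | succ m ih =>
    rw [Finset.sum_range_succ, ih, Finset.sum_range_succ _ m, pSO_odd_succ,
      PhiF_even_succ hτ, show 2 * (m + 1) = 2 * m + 1 + 1 by ring]
    simp only [Nat.factorial_succ]
    push_cast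
    have hfact : (Nat.factorial (2 * m) : ℝ) ≠ 0 := by positivity
    have hodd : 2 * (m : ℝ) + 1 ≠ 0 := by positivity
    have heven : 2 * (m : ℝ) + 1 + 1 ≠ 0 := by positivity
    field_simp
    ring

/-- **Theorem (Skew-orthogonal summation identity, even–odd part).**
`Σ_{k=0}^{N/2−1} Φ_{2k}(x)·p_{2k+1}(x)/(2k)! = 2(1+τ)·e^{−x²/(2(1+τ))}·
Σ_{k=0}^{N/2−2} C_{2k+1}(x)²/(2k+1)! + C_{N−1}(x)·Φ_{N−2}(x)/(N−2)!`. -/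
theorem skew_orthogonal_sum_even_odd (τ : ℝ) (hτ : τ ∈ Set.Icc (0:ℝ) 1)
    (N : ℕ) (hNeven : Even N) (hN2 : 2 ≤ N) (x : ℝ) :
    ∑ k ∈ Finset.range (N/2), PhiF τ (2*k) x * pSO τ (2*k+1) x / (Nat.factorial (2*k) : ℝ)
      = 2*(1+τ) * Real.exp (-x^2/(2*(1+τ))) *
          (∑ k ∈ Finset.range (N/2 - 1), (CH τ (2*k+1) x)^2 / (Nat.factorial (2*k+1) : ℝ))
        + CH τ (N-1) x * PhiF τ (N-2) x / (Nat.factorial (N-2) : ℝ) := by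
  obtain ⟨m, rfl⟩ : ∃ m, N = 2 * (m + 1) := by
    obtain ⟨r, rfl⟩ := hNeven
    exact ⟨r - 1, by omega⟩
  rw [show 2 * (m + 1) / 2 = m + 1 by omega, show 2 * (m + 1) - 1 = 2 * m + 1 by omega,
    show 2 * (m + 1) - 2 = 2 * m by omega, Nat.add_sub_cancel]
  exact sum_PhiF_even_mul_pSO_odd (by linarith [hτ.1]) m x
end
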